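/- Let 0 < p < ∞ with p ≠ 2. Then there exists a radial continuous rapidly increasing weight ω on the unit disc such that for no function φ: [0,1) → (0,∞) do there exist constants C₁, C₂ > 0 with C₁ (∫_𝔻 |f'(z)|^p φ(|z|)^p ω(z) dA(z) + |f(0)|^p) ≤ ∫_𝔻 |f(z)|^p ω(z) dA(z) ≤ C₂ (∫_𝔻 |f'(z)|^p φ(|z|)^p ω(z) dA(z) + |f(0)|^p) for all analytic f on 𝔻. -/

import Mathlib

open MeasureTheory Set Filter

noncomputable section

/-- `wInt ω r = ∫_r^1 ω(s) ds`. -/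
def wInt (ω : ℝ → ℝ) (r : ℝ) : ℝ := ∫ s in r..1, ω s

/-- A radial weight on the unit disc, identified with a function on `[0,1)`:
positive and integrable. -/
def IsRadialWeight (ω : ℝ → ℝ) : Prop :=
  (∀ r ∈ Set.Ico (0:ℝ) 1, 0 < ω r) ∧ IntegrableOn ω (Set.Ico (0:ℝ) 1)

/-- A radial continuous weight. -/
def IsRadialContinuousWeight (ω : ℝ → ℝ) : Prop :=
  IsRadialWeight ω ∧ ContinuousOn ω (Set.Ico (0:ℝ) 1)

/-- A regular weight: radial continuous with `ψ_ω(r) ≍ 1 - r`, i.e.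
`(1-r)·ω(r) ≍ ∫_r^1 ω(s) ds` on `[0,1)`. -/
def IsRegularWeight (ω : ℝ → ℝ) : Prop :=
  IsRadialContinuousWeight ω ∧ ∃ c C : ℝ, 0 < c ∧ 0 < C ∧
    ∀ r ∈ Set.Ico (0:ℝ) 1,
      c * ((1 - r) * ω r) ≤ wInt ω r ∧ wInt ω r ≤ C * ((1 - r) * ω r)

/-- A rapidly increasing weight: radial continuous with
`ψ_ω(r)/(1-r) = (∫_r^1 ω)/(ω(r)(1-r)) → ∞` as `r → 1⁻`. -/
def IsRapidlyIncreasing (ω : ℝ → ℝ) : Prop :=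
  IsRadialContinuousWeight ω ∧
    Tendsto (fun r => wInt ω r / (ω r * (1 - r))) (nhdsWithin 1 (Set.Iio 1)) atTop

/-- The open unit disc in `ℂ`. -/
def unitDisc : Set ℂ := {z : ℂ | ‖z‖ < 1}


lemma sq_rpow_half {x : ℝ} (hx : 0 ≤ x) (p : ℝ) : (x ^ 2) ^ (p / 2) = x ^ p := by
  rw [← Real.rpow_natCast_mul hx]
  congr 1; push_cast; ring

/-- The signed sum `∑ j, σ j * b j` for a choice of signs `σ`. -/
def signedSum {ι : Type*} [Fintype ι] (b : ι → ℂ) (σ : ι → ℤˣ) : ℂ :=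
  ∑ j, ((σ j : ℤ) : ℂ) * b j

lemma sum_signs_mul {ι : Type*} [Fintype ι] [DecidableEq ι] (i j : ι) :
    ∑ σ : ι → ℤˣ, ((σ i : ℤ) : ℂ) * ((σ j : ℤ) : ℂ) =
      if i = j then (Fintype.card (ι → ℤˣ) : ℂ) else 0 := by
  split_ifs with h
  · subst h
    have : ∀ σ : ι → ℤˣ, ((σ i : ℤ) : ℂ) * ((σ i : ℤ) : ℂ) = 1 := fun σ => by
      rw [← Int.cast_mul, ← Units.val_mul, Int.units_mul_self]; simp
    simp [this]
  · have key := Equiv.sum_comp (Equiv.mulRight (Pi.mulSingle i (-1 : ℤˣ)))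
      (fun σ : ι → ℤˣ => ((σ i : ℤ) : ℂ) * ((σ j : ℤ) : ℂ))
    simp only [Equiv.coe_mulRight, Pi.mul_apply, Pi.mulSingle_eq_same,
      Pi.mulSingle_eq_of_ne (Ne.symm h), mul_one, Units.val_neg,
      Int.cast_neg, mul_neg, neg_mul, Finset.sum_neg_distrib] at key
    exact CharZero.neg_eq_self_iff.mp key

/-- Orthogonality of the Rademacher signs. -/
lemma sum_norm_signedSum_sq {ι : Type*} [Fintype ι] [DecidableEq ι] (b : ι → ℂ) :
    ∑ σ, ‖signedSum b σ‖ ^ 2 = Fintype.card (ι → ℤˣ) * ∑ j, ‖b j‖ ^ 2 := by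
  have h : ∀ z : ℂ, ((‖z‖ ^ 2 : ℝ) : ℂ) = z * starRingEnd ℂ z := fun z => by
    rw [Complex.mul_conj, Complex.normSq_eq_norm_sq]
  apply Complex.ofReal_injective
  rw [Complex.ofReal_sum, Complex.ofReal_mul, Complex.ofReal_sum]
  simp only [h, signedSum, map_sum, map_mul, map_intCast, Finset.sum_mul_sum]
  rw [Finset.sum_comm]
  simp_rw [Finset.sum_comm (s := (Finset.univ : Finset (ι → ℤˣ)))]
  have : ∀ i j : ι, ∑ σ : ι → ℤˣ, ((σ i : ℤ) : ℂ) * b i *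
      (((σ j : ℤ) : ℂ) * starRingEnd ℂ (b j)) =
      if i = j then (Fintype.card (ι → ℤˣ) : ℂ) * (b i * starRingEnd ℂ (b j)) else 0 := by
    intro i j
    have e := sum_signs_mul i j
    calc _ = (∑ σ : ι → ℤˣ, ((σ i : ℤ) : ℂ) * ((σ j : ℤ) : ℂ)) *
          (b i * starRingEnd ℂ (b j)) := by
            rw [Finset.sum_mul]; exact Finset.sum_congr rfl fun σ _ => by ring
      _ = _ := by rw [e]; split_ifs <;> simp
  simp [this, Finset.mul_sum]

lemma le_sum_norm_signedSum_rpow {ι : Type*} [Fintype ι] [DecidableEq ι] (b : ι → ℂ)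
    {p : ℝ} (hp : 2 ≤ p) :
    Fintype.card (ι → ℤˣ) * (∑ j, ‖b j‖ ^ 2) ^ (p / 2) ≤ ∑ σ, ‖signedSum b σ‖ ^ p := by
  have hK : (0 : ℝ) < Fintype.card (ι → ℤˣ) := by exact_mod_cast Fintype.card_pos
  have key := Real.rpow_arith_mean_le_arith_mean_rpow Finset.univ
    (fun _ : ι → ℤˣ => ((Fintype.card (ι → ℤˣ) : ℝ))⁻¹) (fun σ => ‖signedSum b σ‖ ^ 2)
    (fun _ _ => by positivity) (by simp) (fun _ _ => by positivity)
    (p := p / 2) (by linarith)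
  rw [← Finset.mul_sum, ← Finset.mul_sum, sum_norm_signedSum_sq, inv_mul_cancel_left₀ hK.ne',
    ← div_eq_inv_mul, le_div_iff₀' hK] at key
  refine key.trans_eq (Finset.sum_congr rfl fun σ _ => ?_)
  exact sq_rpow_half (norm_nonneg _) p

lemma sum_norm_signedSum_rpow_le {ι : Type*} [Fintype ι] [DecidableEq ι] (b : ι → ℂ)
    {p : ℝ} (hp0 : 0 < p) (hp : p ≤ 2) :
    ∑ σ, ‖signedSum b σ‖ ^ p ≤ Fintype.card (ι → ℤˣ) * (∑ j, ‖b j‖ ^ 2) ^ (p / 2) := by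
  have hK : (0 : ℝ) < Fintype.card (ι → ℤˣ) := by exact_mod_cast Fintype.card_pos
  have key := Real.rpow_arith_mean_le_arith_mean_rpow Finset.univ
    (fun _ : ι → ℤˣ => ((Fintype.card (ι → ℤˣ) : ℝ))⁻¹) (fun σ => ‖signedSum b σ‖ ^ p)
    (fun _ _ => by positivity) (by simp) (fun _ _ => by positivity)
    (p := 2 / p) (by rw [le_div_iff₀ hp0]; linarith)
  have e : ∀ σ, (‖signedSum b σ‖ ^ p) ^ (2 / p) = ‖signedSum b σ‖ ^ 2 := fun σ => by
    rw [← Real.rpow_mul (norm_nonneg _), mul_div_cancel₀ _ hp0.ne', Real.rpow_two]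
  simp only [e] at key
  rw [← Finset.mul_sum, ← Finset.mul_sum, sum_norm_signedSum_sq,
    inv_mul_cancel_left₀ hK.ne'] at key
  have h0 : 0 ≤ (Fintype.card (ι → ℤˣ) : ℝ)⁻¹ * ∑ σ, ‖signedSum b σ‖ ^ p := by positivity
  have := Real.rpow_le_rpow (by positivity) key (by positivity : 0 ≤ p / 2)
  rw [← Real.rpow_mul h0, div_mul_div_cancel₀ hp0.ne', div_self two_ne_zero, Real.rpow_one,
    ← div_eq_inv_mul, div_le_iff₀' hK] at this
  exact this

/-- Flipping one sign shows that each summand is controlled by the average of the signed sums. -/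
lemma norm_rpow_le_sum_norm_signedSum_rpow {ι : Type*} [Fintype ι] [DecidableEq ι] (b : ι → ℂ)
    {p : ℝ} (hp : 0 < p) (i : ι) :
    Fintype.card (ι → ℤˣ) * ‖b i‖ ^ p ≤ 2 * ∑ σ, ‖signedSum b σ‖ ^ p := by
  have key := Equiv.sum_comp (Equiv.mulRight (Pi.mulSingle i (-1 : ℤˣ)))
      (fun σ : ι → ℤˣ => ‖signedSum b σ‖ ^ p)
  rw [two_mul]
  nth_rewrite 2 [← key]
  rw [← Finset.sum_add_distrib, ← nsmul_eq_mul, ← Finset.card_univ, ← Finset.sum_const]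
  refine Finset.sum_le_sum fun σ _ => ?_
  set τ := (Equiv.mulRight (Pi.mulSingle i (-1 : ℤˣ))) σ with hτ
  have hd : signedSum b σ - signedSum b τ = 2 * (((σ i : ℤ) : ℂ) * b i) := by
    unfold signedSum
    rw [← Finset.sum_sub_distrib, Finset.sum_eq_single i]
    · simp [hτ]; ring
    · intro j _ hj
      simp [hτ, Pi.mulSingle_eq_of_ne hj]
    · simp
  have hn : ‖((σ i : ℤ) : ℂ)‖ = 1 := by
    rcases Int.units_eq_one_or (σ i) with h | h <;> simp [h]
  have h2 : 2 * ‖b i‖ ≤ ‖signedSum b σ‖ + ‖signedSum b τ‖ := by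
    have := norm_sub_le (signedSum b σ) (signedSum b τ)
    rw [hd] at this
    simpa only [norm_mul, hn, one_mul, Complex.norm_ofNat] using this
  have p1 : 0 ≤ ‖signedSum b σ‖ ^ p := by positivity
  have p2 : 0 ≤ ‖signedSum b τ‖ ^ p := by positivity
  rcases le_total ‖b i‖ ‖signedSum b σ‖ with h | h
  · have := Real.rpow_le_rpow (norm_nonneg _) h hp.le
    linarith
  · have : ‖b i‖ ≤ ‖signedSum b τ‖ := by linarith
    have := Real.rpow_le_rpow (norm_nonneg _) this hp.le
    linarith

lemma norm_signedSum_le {ι : Type*} [Fintype ι] (b : ι → ℂ) (σ : ι → ℤˣ) :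
    ‖signedSum b σ‖ ≤ ∑ j, ‖b j‖ := by
  refine (norm_sum_le _ _).trans_eq (Finset.sum_congr rfl fun j _ => ?_)
  rcases Int.units_eq_one_or (σ j) with h | h <;> simp [h]

lemma sum_range_min_geometric_le {A s m : ℝ} (hA : 1 < A) (hs : 0 < s) (hm : 0 ≤ m) (J : ℕ) :
    ∑ j ∈ Finset.range J, min (s * A ^ j) (m ^ 2 / (s * A ^ j)) ≤
      2 * (A + 1) / (A - 1) * m := by
  have hA' : 0 < A - 1 := by linarith
  rcases hm.eq_or_lt with rfl | hm
  · simp only [mul_zero]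
    refine Finset.sum_nonpos fun j _ => (min_le_right _ _).trans ?_
    simp
  set Φ : ℕ → ℝ := fun j => s * A ^ j * m / (m + s * A ^ j) with hΦ
  have hstep : ∀ j, min (s * A ^ j) (m ^ 2 / (s * A ^ j)) ≤
      2 * (A + 1) / (A - 1) * (Φ (j + 1) - Φ j) := by
    intro j
    have ht : 0 < s * A ^ j := by positivity
    have e : Φ (j + 1) - Φ j = (A - 1) * (s * A ^ j) * m ^ 2 /
        ((m + A * (s * A ^ j)) * (m + s * A ^ j)) := by
      simp only [hΦ, pow_succ]
      have : s * (A ^ j * A) = A * (s * A ^ j) := by ring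
      rw [this]
      field_simp
      ring
    rw [e]
    generalize s * A ^ j = t at ht
    have e2 : 2 * (A + 1) / (A - 1) * ((A - 1) * t * m ^ 2 / ((m + A * t) * (m + t))) =
        2 * (A + 1) * t * m ^ 2 / ((m + A * t) * (m + t)) := by
      field_simp
    rw [e2]
    rcases le_total t m with h | h
    · refine (min_le_left _ _).trans ?_
      rw [le_div_iff₀ (by positivity)]
      have : (m + A * t) * (m + t) ≤ ((1 + A) * m) * (2 * m) := by
        gcongr <;> nlinarith
      nlinarith
    · refine (min_le_right _ _).trans ?_
      rw [div_le_div_iff₀ ht (by positivity)]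
      have : (m + A * t) * (m + t) ≤ ((1 + A) * t) * (2 * t) := by
        gcongr <;> nlinarith
      nlinarith [sq_nonneg m, mul_le_mul_of_nonneg_left this (sq_nonneg m)]
  have hb : Φ J - Φ 0 ≤ m := by
    have h0 : 0 ≤ Φ 0 := by simp only [hΦ]; positivity
    have h1 : Φ J ≤ m := by
      simp only [hΦ]
      have : 0 < s * A ^ J := by positivity
      rw [div_le_iff₀ (by positivity)]
      nlinarith
    linarith
  calc _ ≤ ∑ j ∈ Finset.range J, 2 * (A + 1) / (A - 1) * (Φ (j + 1) - Φ j) :=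
        Finset.sum_le_sum fun j _ => hstep j
    _ = 2 * (A + 1) / (A - 1) * (Φ J - Φ 0) := by rw [← Finset.mul_sum, Finset.sum_range_sub]
    _ ≤ _ := by gcongr

/-- The modulus of the derivative of `z ^ 2 ^ j` on the circle of radius `r`. -/
def dyadicDeriv (r : ℝ) (j : ℕ) : ℝ := 2 ^ j * r ^ (2 ^ j - 1)

lemma dyadicDeriv_nonneg {r : ℝ} (hr : 0 ≤ r) (j : ℕ) : 0 ≤ dyadicDeriv r j := by
  unfold dyadicDeriv; positivity

lemma dyadicDeriv_succ_le {r M : ℝ} (hr : 0 ≤ r) (hr1 : r ≤ 1) {j : ℕ}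
    (hM : dyadicDeriv r j ≤ M) :
    dyadicDeriv r (j + 1) ≤ 2 * min (2 ^ j) (M ^ 2 / 2 ^ j) := by
  rw [mul_min_of_nonneg _ _ zero_le_two]
  refine le_min ?_ ?_
  · unfold dyadicDeriv
    have : r ^ (2 ^ (j + 1) - 1) ≤ 1 := pow_le_one₀ hr hr1
    rw [pow_succ (2:ℝ)]
    nlinarith [pow_pos (two_pos : (0:ℝ) < 2) j]
  · have h1 : dyadicDeriv r j ^ 2 ≤ M ^ 2 := pow_le_pow_left₀ (dyadicDeriv_nonneg hr j) hM 2
    refine le_trans ?_ (mul_le_mul_of_nonneg_left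
      (div_le_div_of_nonneg_right h1 (by positivity : (0:ℝ) ≤ 2 ^ j)) zero_le_two)
    unfold dyadicDeriv
    have h2 : r ^ (2 ^ (j + 1) - 1) ≤ (r ^ (2 ^ j - 1)) ^ 2 := by
      rw [← pow_mul]
      apply pow_le_pow_of_le_one hr hr1
      rw [pow_succ]; omega
    calc (2:ℝ) ^ (j + 1) * r ^ (2 ^ (j + 1) - 1) ≤ 2 ^ (j + 1) * (r ^ (2 ^ j - 1)) ^ 2 := by gcongr
      _ = _ := by field_simp; ring

lemma sum_dyadicDeriv_rpow_le {r M q : ℝ} (hr : 0 ≤ r) (hr1 : r ≤ 1) (hq : 0 < q) (hM0 : 0 ≤ M)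
    (a J : ℕ) (hM : ∀ j < J, dyadicDeriv r (a + j) ≤ M) :
    ∑ j ∈ Finset.range J, dyadicDeriv r (a + j + 1) ^ q ≤
      2 ^ q * (2 * (2 ^ q + 1) / (2 ^ q - 1)) * M ^ q := by
  have h2 : (1:ℝ) < 2 ^ q := Real.one_lt_rpow one_lt_two hq
  have key := sum_range_min_geometric_le (A := 2 ^ q) (s := (2 ^ a) ^ q) (m := M ^ q) h2
    (by positivity) (by positivity) J
  rw [mul_assoc]
  refine le_trans ?_ (mul_le_mul_of_nonneg_left key (by positivity))
  rw [Finset.mul_sum]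
  refine Finset.sum_le_sum fun j hj => ?_
  have h := dyadicDeriv_succ_le hr hr1 (hM j (Finset.mem_range.mp hj))
  have h' := Real.rpow_le_rpow (dyadicDeriv_nonneg hr _) h hq.le
  refine h'.trans ?_
  have hs : ((2:ℝ) ^ a) ^ q * (2 ^ q) ^ j = (2 ^ (a + j)) ^ q := by
    rw [pow_add, Real.mul_rpow (by positivity) (by positivity)]
    congr 1
    rw [← Real.rpow_mul_natCast (by positivity), ← Real.rpow_natCast_mul (by positivity), mul_comm]
  rw [hs, Real.mul_rpow zero_le_two (by positivity)]
  gcongr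
  refine le_min (Real.rpow_le_rpow (by positivity) (min_le_left _ _) hq.le) ?_
  refine (Real.rpow_le_rpow (by positivity) (min_le_right _ _) hq.le).trans_eq ?_
  rw [Real.div_rpow (by positivity) (by positivity), ← Real.rpow_natCast_mul hM0,
    ← Real.rpow_mul_natCast hM0, mul_comm]

lemma not_forall_rpow_le_mul_rpow {s t B : ℝ} (hst : s < t) :
    ¬ ∀ J : ℕ, 1 ≤ J → (J : ℝ) ^ t ≤ B * (J : ℝ) ^ s := by
  intro h
  have ht := (tendsto_rpow_atTop (sub_pos.mpr hst)).comp (tendsto_natCast_atTop_atTop (R := ℝ))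
  obtain ⟨J, hJ, hJ1⟩ := ((ht.eventually_gt_atTop B).and (eventually_ge_atTop 1)).exists
  have hJ0 : (0:ℝ) < J := by exact_mod_cast hJ1
  have := h J hJ1
  simp only [Function.comp_apply] at hJ
  rw [Real.rpow_sub hJ0, lt_div_iff₀ (by positivity)] at hJ
  linarith

lemma differentiable_signedSum_pow {ι : Type*} [Fintype ι] (n : ι → ℕ) (σ : ι → ℤˣ) :
    Differentiable ℂ fun z : ℂ => signedSum (fun i => z ^ n i) σ := by
  unfold signedSum; fun_prop

lemma deriv_signedSum_pow {ι : Type*} [Fintype ι] (n : ι → ℕ) (σ : ι → ℤˣ) (z : ℂ) :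
    deriv (fun z : ℂ => signedSum (fun i => z ^ n i) σ) z =
      signedSum (fun i => (n i : ℂ) * z ^ (n i - 1)) σ := by
  unfold signedSum
  exact (HasDerivAt.fun_sum fun i _ => (hasDerivAt_pow (n i) z).const_mul _).deriv

lemma norm_dyadic_monomial_deriv (z : ℂ) (j : ℕ) :
    ‖((2 ^ j : ℕ) : ℂ) * z ^ (2 ^ j - 1)‖ = dyadicDeriv ‖z‖ j := by
  simp [dyadicDeriv]

lemma measurable_dyadicDeriv_norm_rpow (p : ℝ) (j : ℕ) :
    Measurable fun z : ℂ => ENNReal.ofReal (dyadicDeriv ‖z‖ j ^ p) := by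
  unfold dyadicDeriv; fun_prop

/-- The `p`-th power comparison of `f` in `L^p(lam)` and `f'` in `L^p(ν)`, for entire functions
vanishing at the origin. -/
def DerivComparable (p : ℝ) (lam ν : Measure ℂ) (C₁ C₂ : ℝ) : Prop :=
  ∀ f : ℂ → ℂ, Differentiable ℂ f → f 0 = 0 →
    ENNReal.ofReal C₁ * ∫⁻ z, ENNReal.ofReal (‖deriv f z‖ ^ p) ∂ν ≤
        ∫⁻ z, ENNReal.ofReal (‖f z‖ ^ p) ∂lam ∧
      ∫⁻ z, ENNReal.ofReal (‖f z‖ ^ p) ∂lam ≤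
        ENNReal.ofReal C₂ * ∫⁻ z, ENNReal.ofReal (‖deriv f z‖ ^ p) ∂ν

namespace DerivComparable

variable {p C₁ C₂ : ℝ} {lam ν : Measure ℂ} {w : ℕ → ℝ}

lemma dyadic (h : DerivComparable p lam ν C₁ C₂) (hC₁ : 0 < C₁) (hC₂ : 0 < C₂)
    (hw : ∀ j, ∫⁻ z, ENNReal.ofReal ((‖z‖ ^ 2 ^ j) ^ p) ∂lam = ENNReal.ofReal (w j)) (j : ℕ) :
    ENNReal.ofReal (w j / C₂) ≤ ∫⁻ z, ENNReal.ofReal (dyadicDeriv ‖z‖ j ^ p) ∂ν ∧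
      ∫⁻ z, ENNReal.ofReal (dyadicDeriv ‖z‖ j ^ p) ∂ν ≤ ENNReal.ofReal (w j / C₁) := by
  obtain ⟨h1, h2⟩ := h (fun z => z ^ 2 ^ j) (by fun_prop) (by simp)
  have hd : ∀ z : ℂ, deriv (fun z : ℂ => z ^ 2 ^ j) z = ((2 ^ j : ℕ) : ℂ) * z ^ (2 ^ j - 1) :=
    fun z => (hasDerivAt_pow (2 ^ j) z).deriv
  simp only [hd, norm_dyadic_monomial_deriv, norm_pow, hw] at h1 h2
  have c1 : ENNReal.ofReal C₁ ≠ 0 := by simpa using hC₁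
  have c2 : ENNReal.ofReal C₂ ≠ 0 := by simpa using hC₂
  rw [ENNReal.ofReal_div_of_pos hC₁, ENNReal.ofReal_div_of_pos hC₂]
  refine ⟨ENNReal.div_le_of_le_mul' h2, ?_⟩
  rw [ENNReal.le_div_iff_mul_le (Or.inl c1) (Or.inl ENNReal.ofReal_ne_top), mul_comm]
  exact h1

lemma signedSum (h : DerivComparable p lam ν C₁ C₂) {J : ℕ} {n : Fin J → ℕ} (hn : ∀ i, n i ≠ 0) :
    ENNReal.ofReal C₁ * ∫⁻ z, ENNReal.ofReal
          (∑ σ, ‖signedSum (fun i => (n i : ℂ) * z ^ (n i - 1)) σ‖ ^ p) ∂ν ≤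
        ∫⁻ z, ENNReal.ofReal (∑ σ, ‖signedSum (fun i => z ^ n i) σ‖ ^ p) ∂lam ∧
      ∫⁻ z, ENNReal.ofReal (∑ σ, ‖signedSum (fun i => z ^ n i) σ‖ ^ p) ∂lam ≤
        ENNReal.ofReal C₂ * ∫⁻ z, ENNReal.ofReal
          (∑ σ, ‖signedSum (fun i => (n i : ℂ) * z ^ (n i - 1)) σ‖ ^ p) ∂ν := by
  have key := fun σ : Fin J → ℤˣ => h (fun z => _root_.signedSum (fun i => z ^ n i) σ)
    (differentiable_signedSum_pow n σ) (by simp [_root_.signedSum, hn])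
  simp only [deriv_signedSum_pow] at key
  have hpos : ∀ (b : Fin J → ℂ) (σ : Fin J → ℤˣ), 0 ≤ ‖_root_.signedSum b σ‖ ^ p :=
    fun b σ => by positivity
  simp only [ENNReal.ofReal_sum_of_nonneg fun σ _ => hpos _ σ]
  rw [lintegral_finsetSum, lintegral_finsetSum, Finset.mul_sum, Finset.mul_sum]
  · exact ⟨Finset.sum_le_sum fun σ _ => (key σ).1, Finset.sum_le_sum fun σ _ => (key σ).2⟩
  · intro σ _; unfold _root_.signedSum; fun_prop
  · intro σ _; unfold _root_.signedSum; fun_prop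

lemma lintegral_sum_dyadic (J a : ℕ) :
    ∫⁻ z, ENNReal.ofReal (∑ j ∈ Finset.range J, dyadicDeriv ‖z‖ (a + j) ^ p) ∂ν =
      ∑ j ∈ Finset.range J, ∫⁻ z, ENNReal.ofReal (dyadicDeriv ‖z‖ (a + j) ^ p) ∂ν := by
  rw [← lintegral_finsetSum _ fun j _ => measurable_dyadicDeriv_norm_rpow p (a + j)]
  refine lintegral_congr fun z => ?_
  rw [ENNReal.ofReal_sum_of_nonneg]
  intro j _
  have := dyadicDeriv_nonneg (norm_nonneg z) (a + j)
  positivity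

lemma rpow_le_of_two_lt (h : DerivComparable p lam ν C₁ C₂) (hp2 : 2 < p) (hC₁ : 0 < C₁)
    (hC₂ : 0 < C₂) (hlam : ∀ᵐ z ∂lam, ‖z‖ ≤ 1) (hν : ∀ᵐ z ∂ν, ‖z‖ ≤ 1)
    (hw : ∀ j, ∫⁻ z, ENNReal.ofReal ((‖z‖ ^ 2 ^ j) ^ p) ∂lam = ENNReal.ofReal (w j))
    (hwpos : ∀ j, 0 < w j) (hanti : Antitone w) {J a : ℕ} (hJ : 1 ≤ J)
    (ha : w a ≤ 2 * w (a + J)) :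
    (J : ℝ) ^ (p / 2) ≤
      2 * C₂ * (2 ^ (1:ℝ) * (2 * (2 ^ (1:ℝ) + 1) / (2 ^ (1:ℝ) - 1))) ^ p / C₁ * (J : ℝ) ^ (1:ℝ) := by
  set K := (Fintype.card (Fin J → ℤˣ) : ℝ) with hKdef
  have hK : 0 < K := by rw [hKdef]; exact_mod_cast Fintype.card_pos
  set B : ℝ := 2 ^ (1:ℝ) * (2 * (2 ^ (1:ℝ) + 1) / (2 ^ (1:ℝ) - 1)) with hB
  have hBpos : 0 < B := by rw [hB]; norm_num
  have hJ0 : (0:ℝ) < J := by exact_mod_cast hJ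
  set n : Fin J → ℕ := fun i => 2 ^ (a + i + 1) with hn
  have hmain := (h.signedSum (n := n) (fun i => by simp [hn])).2
  have hlow : ENNReal.ofReal (K * (J : ℝ) ^ (p / 2) * w (a + J)) ≤
      ∫⁻ z, ENNReal.ofReal (∑ σ, ‖_root_.signedSum (fun i => z ^ n i) σ‖ ^ p) ∂lam := by
    rw [ENNReal.ofReal_mul (by positivity), ← hw, ← lintegral_const_mul' _ _ ENNReal.ofReal_ne_top]
    refine lintegral_mono_ae (hlam.mono fun z hz => ?_)
    rw [← ENNReal.ofReal_mul (by positivity)]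
    refine ENNReal.ofReal_le_ofReal (le_trans ?_ (le_sum_norm_signedSum_rpow _ hp2.le))
    rw [mul_assoc]
    refine mul_le_mul_of_nonneg_left ?_ hK.le
    have e : (‖z‖ ^ 2 ^ (a + J)) ^ p = ((‖z‖ ^ 2 ^ (a + J)) ^ 2) ^ (p / 2) :=
      (sq_rpow_half (by positivity) p).symm
    rw [e, ← Real.mul_rpow (by positivity) (by positivity)]
    refine Real.rpow_le_rpow (by positivity) ?_ (by positivity)
    calc (J : ℝ) * (‖z‖ ^ 2 ^ (a + J)) ^ 2 = ∑ _j : Fin J, (‖z‖ ^ 2 ^ (a + J)) ^ 2 := by simp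
      _ ≤ _ := by
        refine Finset.sum_le_sum fun i _ => ?_
        rw [norm_pow]
        refine pow_le_pow_left₀ (by positivity) ?_ 2
        refine pow_le_pow_of_le_one (norm_nonneg _) hz ?_
        exact Nat.pow_le_pow_right two_pos (by have := i.2; omega)
  have hup : ∫⁻ z, ENNReal.ofReal
        (∑ σ, ‖_root_.signedSum (fun i => (n i : ℂ) * z ^ (n i - 1)) σ‖ ^ p) ∂ν ≤
      ENNReal.ofReal (K * B ^ p * (J * (w a / C₁))) := by
    have step : ∫⁻ z, ENNReal.ofReal
        (∑ σ, ‖_root_.signedSum (fun i => (n i : ℂ) * z ^ (n i - 1)) σ‖ ^ p) ∂ν ≤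
        ∫⁻ z, ENNReal.ofReal (K * B ^ p) *
          ENNReal.ofReal (∑ j ∈ Finset.range J, dyadicDeriv ‖z‖ (a + j) ^ p) ∂ν := by
      refine lintegral_mono_ae (hν.mono fun z hz => ?_)
      rw [← ENNReal.ofReal_mul (by positivity)]
      refine ENNReal.ofReal_le_ofReal ?_
      obtain ⟨m, hm, hmax⟩ := Finset.exists_max_image (Finset.range J)
        (fun j => dyadicDeriv ‖z‖ (a + j)) ⟨0, Finset.mem_range.mpr hJ⟩
      have hM0 := dyadicDeriv_nonneg (norm_nonneg z) (a + m)
      have hsum := sum_dyadicDeriv_rpow_le (norm_nonneg z) hz one_pos hM0 a J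
        fun j hj => hmax j (Finset.mem_range.mpr hj)
      rw [← hB] at hsum
      simp only [Real.rpow_one] at hsum
      have hσ : ∀ σ, ‖_root_.signedSum (fun i => (n i : ℂ) * z ^ (n i - 1)) σ‖ ^ p ≤
          B ^ p * ∑ j ∈ Finset.range J, dyadicDeriv ‖z‖ (a + j) ^ p := by
        intro σ
        have h1 : ‖_root_.signedSum (fun i => (n i : ℂ) * z ^ (n i - 1)) σ‖ ≤
            B * dyadicDeriv ‖z‖ (a + m) := by
          refine (norm_signedSum_le _ _).trans (le_trans (le_of_eq ?_) hsum)
          simp only [hn, norm_dyadic_monomial_deriv]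
          exact Fin.sum_univ_eq_sum_range (fun j => dyadicDeriv ‖z‖ (a + j + 1)) J
        refine (Real.rpow_le_rpow (norm_nonneg _) h1 (by linarith)).trans ?_
        rw [Real.mul_rpow hBpos.le hM0]
        refine mul_le_mul_of_nonneg_left ?_ (by positivity)
        exact Finset.single_le_sum (f := fun j => dyadicDeriv ‖z‖ (a + j) ^ p)
          (fun j _ => Real.rpow_nonneg (dyadicDeriv_nonneg (norm_nonneg z) _) _) hm
      refine (Finset.sum_le_sum fun σ _ => hσ σ).trans_eq ?_
      rw [Finset.sum_const, Finset.card_univ, nsmul_eq_mul, ← hKdef, mul_assoc]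
    refine step.trans ?_
    rw [lintegral_const_mul' _ _ ENNReal.ofReal_ne_top, lintegral_sum_dyadic,
      ENNReal.ofReal_mul (by positivity : 0 ≤ K * B ^ p)]
    gcongr
    calc _ ≤ ∑ j ∈ Finset.range J, ENNReal.ofReal (w a / C₁) := by
          refine Finset.sum_le_sum fun j _ => ((h.dyadic hC₁ hC₂ hw _).2).trans ?_
          gcongr
          exact hanti (Nat.le_add_right _ _)
      _ = _ := by
        rw [Finset.sum_const, Finset.card_range, nsmul_eq_mul, ENNReal.ofReal_mul hJ0.le,
          ENNReal.ofReal_natCast]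
  have hfin := hlow.trans (hmain.trans (mul_le_mul_right hup _))
  rw [← ENNReal.ofReal_mul hC₂.le, ENNReal.ofReal_le_ofReal_iff
    (by have := hwpos a; positivity)] at hfin
  have hw0 := hwpos (a + J)
  rw [Real.rpow_one]
  have h2 : C₂ * (K * B ^ p * (J * (w a / C₁))) ≤
      C₂ * (K * B ^ p * (J * (2 * w (a + J) / C₁))) := by gcongr
  have h3 := hfin.trans h2
  have h4 : C₂ * (K * B ^ p * (J * (2 * w (a + J) / C₁))) =
      (K * w (a + J)) * (2 * C₂ * B ^ p / C₁ * J) := by ring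
  have h5 : K * (J : ℝ) ^ (p / 2) * w (a + J) = (K * w (a + J)) * (J : ℝ) ^ (p / 2) := by ring
  rw [h4, h5] at h3
  exact le_of_mul_le_mul_left h3 (by positivity)

lemma le_rpow_of_lt_two (h : DerivComparable p lam ν C₁ C₂) (hp : 0 < p) (hp2 : p < 2)
    (hC₁ : 0 < C₁) (hC₂ : 0 < C₂) (hlam : ∀ᵐ z ∂lam, ‖z‖ ≤ 1) (hν : ∀ᵐ z ∂ν, ‖z‖ ≤ 1)
    (hw : ∀ j, ∫⁻ z, ENNReal.ofReal ((‖z‖ ^ 2 ^ j) ^ p) ∂lam = ENNReal.ofReal (w j))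
    (hwpos : ∀ j, 0 < w j) (hanti : Antitone w) {J a : ℕ} (hJ : 1 ≤ J)
    (ha : w a ≤ 2 * w (a + J)) :
    (J : ℝ) ^ (1:ℝ) ≤
      4 * C₂ * (2 ^ p * (2 * (2 ^ p + 1) / (2 ^ p - 1))) / C₁ * (J : ℝ) ^ (p / 2) := by
  set K := (Fintype.card (Fin J → ℤˣ) : ℝ) with hKdef
  have hK : 0 < K := by rw [hKdef]; exact_mod_cast Fintype.card_pos
  set B : ℝ := 2 ^ p * (2 * (2 ^ p + 1) / (2 ^ p - 1)) with hB
  have hBpos : 0 < B := by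
    have : 0 < (2:ℝ) ^ p - 1 := sub_pos.mpr (Real.one_lt_rpow one_lt_two hp)
    rw [hB]; positivity
  have hJ0 : (0:ℝ) < J := by exact_mod_cast hJ
  set n : Fin J → ℕ := fun i => 2 ^ (a + i) with hn
  have hmain := (h.signedSum (n := n) (fun i => by simp [hn])).1
  have hup : ∫⁻ z, ENNReal.ofReal (∑ σ, ‖_root_.signedSum (fun i => z ^ n i) σ‖ ^ p) ∂lam ≤
      ENNReal.ofReal (K * (J : ℝ) ^ (p / 2) * w a) := by
    rw [ENNReal.ofReal_mul (by positivity), ← hw, ← lintegral_const_mul' _ _ ENNReal.ofReal_ne_top]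
    refine lintegral_mono_ae (hlam.mono fun z hz => ?_)
    rw [← ENNReal.ofReal_mul (by positivity)]
    refine ENNReal.ofReal_le_ofReal (le_trans (sum_norm_signedSum_rpow_le _ hp hp2.le) ?_)
    rw [mul_assoc]
    refine mul_le_mul_of_nonneg_left ?_ hK.le
    have e : (‖z‖ ^ 2 ^ a) ^ p = ((‖z‖ ^ 2 ^ a) ^ 2) ^ (p / 2) :=
      (sq_rpow_half (by positivity) p).symm
    rw [e, ← Real.mul_rpow (by positivity) (by positivity)]
    refine Real.rpow_le_rpow (by positivity) ?_ (by positivity)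
    calc _ ≤ ∑ _j : Fin J, (‖z‖ ^ 2 ^ a) ^ 2 := by
          refine Finset.sum_le_sum fun i _ => ?_
          rw [norm_pow]
          refine pow_le_pow_left₀ (by positivity) ?_ 2
          refine pow_le_pow_of_le_one (norm_nonneg _) hz ?_
          exact Nat.pow_le_pow_right two_pos (by omega)
      _ = _ := by simp
  have hlow : ENNReal.ofReal (K / (2 * B) * (J * (w (a + J) / C₂))) ≤ ∫⁻ z, ENNReal.ofReal
        (∑ σ, ‖_root_.signedSum (fun i => (n i : ℂ) * z ^ (n i - 1)) σ‖ ^ p) ∂ν := by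
    have step : ∫⁻ z, ENNReal.ofReal (K / (2 * B)) *
          ENNReal.ofReal (∑ j ∈ Finset.range J, dyadicDeriv ‖z‖ (a + 1 + j) ^ p) ∂ν ≤
        ∫⁻ z, ENNReal.ofReal
        (∑ σ, ‖_root_.signedSum (fun i => (n i : ℂ) * z ^ (n i - 1)) σ‖ ^ p) ∂ν := by
      refine lintegral_mono_ae (hν.mono fun z hz => ?_)
      rw [← ENNReal.ofReal_mul (by positivity)]
      refine ENNReal.ofReal_le_ofReal ?_
      obtain ⟨m, hm, hmax⟩ := Finset.exists_max_image (Finset.range J)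
        (fun j => dyadicDeriv ‖z‖ (a + j)) ⟨0, Finset.mem_range.mpr hJ⟩
      have hM0 := dyadicDeriv_nonneg (norm_nonneg z) (a + m)
      have hsum := sum_dyadicDeriv_rpow_le (norm_nonneg z) hz hp hM0 a J
        fun j hj => hmax j (Finset.mem_range.mpr hj)
      rw [← hB] at hsum
      have hflip := norm_rpow_le_sum_norm_signedSum_rpow
        (fun i => (n i : ℂ) * z ^ (n i - 1)) hp ⟨m, Finset.mem_range.mp hm⟩
      simp only [hn, norm_dyadic_monomial_deriv] at hflip
      rw [← hKdef] at hflip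
      simp only [add_right_comm a 1]
      calc _ ≤ K / (2 * B) * (B * dyadicDeriv ‖z‖ (a + m) ^ p) := by gcongr
        _ = K * dyadicDeriv ‖z‖ (a + m) ^ p / 2 := by field_simp
        _ ≤ _ := by rw [div_le_iff₀' two_pos]; exact hflip
    refine le_trans ?_ step
    rw [lintegral_const_mul' _ _ ENNReal.ofReal_ne_top, lintegral_sum_dyadic,
      ENNReal.ofReal_mul (by positivity : 0 ≤ K / (2 * B))]
    gcongr
    calc _ = ∑ j ∈ Finset.range J, ENNReal.ofReal (w (a + J) / C₂) := by
          rw [Finset.sum_const, Finset.card_range, nsmul_eq_mul, ENNReal.ofReal_mul hJ0.le,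
            ENNReal.ofReal_natCast]
      _ ≤ _ := by
          refine Finset.sum_le_sum fun j hj => le_trans ?_ (h.dyadic hC₁ hC₂ hw _).1
          gcongr
          exact hanti (by have := Finset.mem_range.mp hj; omega)
  have hfin := (mul_le_mul_right hlow (ENNReal.ofReal C₁)).trans (hmain.trans hup)
  rw [← ENNReal.ofReal_mul hC₁.le, ENNReal.ofReal_le_ofReal_iff
    (by have := hwpos a; positivity)] at hfin
  have hw0 := hwpos (a + J)
  rw [Real.rpow_one]
  have h2 : K * (J : ℝ) ^ (p / 2) * w a ≤ K * (J : ℝ) ^ (p / 2) * (2 * w (a + J)) := by gcongr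
  have h3 := hfin.trans h2
  have h4 : C₁ * (K / (2 * B) * (J * (w (a + J) / C₂))) =
      (K * w (a + J)) * (J * C₁ / (2 * B * C₂)) := by field_simp
  have h5 : K * (J : ℝ) ^ (p / 2) * (2 * w (a + J)) =
      (K * w (a + J)) * (2 * (J : ℝ) ^ (p / 2)) := by ring
  rw [h4, h5] at h3
  have h6 := le_of_mul_le_mul_left h3 (by positivity)
  rw [div_le_iff₀ (by positivity)] at h6
  rw [div_mul_eq_mul_div, le_div_iff₀ hC₁]
  linarith

/-- No pair of measures whose dyadic moments decay slowly admits a derivative comparison. -/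
theorem false_of_slow_moments (h : DerivComparable p lam ν C₁ C₂) (hp : 0 < p) (hp2 : p ≠ 2)
    (hC₁ : 0 < C₁) (hC₂ : 0 < C₂) (hlam : ∀ᵐ z ∂lam, ‖z‖ ≤ 1) (hν : ∀ᵐ z ∂ν, ‖z‖ ≤ 1)
    (hw : ∀ j, ∫⁻ z, ENNReal.ofReal ((‖z‖ ^ 2 ^ j) ^ p) ∂lam = ENNReal.ofReal (w j))
    (hwpos : ∀ j, 0 < w j) (hanti : Antitone w)
    (hslow : ∀ J, 1 ≤ J → ∃ a, w a ≤ 2 * w (a + J)) : False := by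
  rcases hp2.lt_or_gt with hlt | hgt
  · have key := fun J hJ => (hslow J hJ).elim fun a ha =>
      h.le_rpow_of_lt_two hp hlt hC₁ hC₂ hlam hν hw hwpos hanti hJ ha
    exact not_forall_rpow_le_mul_rpow (by linarith) key
  · have key := fun J hJ => (hslow J hJ).elim fun a ha =>
      h.rpow_le_of_two_lt hgt hC₁ hC₂ hlam hν hw hwpos hanti hJ ha
    exact not_forall_rpow_le_mul_rpow (by linarith) key

end DerivComparable

lemma lintegral_mul_eq_lintegral_withDensity {α : Type*} [MeasurableSpace α] {μ : Measure α}
    [SigmaFinite μ] {h : α → ENNReal} (hh : Measurable h) (hfin : ∀ x, h x < ⊤) (u : α → ENNReal) :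
    ∫⁻ x, h x * u x ∂μ = ∫⁻ x, h x ∂(μ.withDensity u) := by
  obtain ⟨g, hg, hgu, hgeq⟩ := exists_measurable_le_withDensity_eq (μ := μ) u
  rw [← hgeq, lintegral_withDensity_eq_lintegral_mul μ hg hh]
  apply le_antisymm
  · have e := lintegral_withDensity_eq_lintegral_mul_non_measurable μ hh (ae_of_all _ hfin) u
    simp only [Pi.mul_apply] at e ⊢
    obtain ⟨v, hv, hvu, hveq⟩ := exists_measurable_le_lintegral_eq (μ := μ.withDensity h) u
    rw [← e, hveq, lintegral_withDensity_eq_lintegral_mul μ hh hv]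
    have hvg : v ≤ᵐ[μ] g := by
      refine ae_le_of_forall_setLIntegral_le_of_sigmaFinite hv fun s hs _ => ?_
      rw [← withDensity_apply g hs, hgeq, withDensity_apply u hs]
      exact lintegral_mono hvu
    refine lintegral_mono_ae (hvg.mono fun x hx => ?_)
    simp only [Pi.mul_apply]
    rw [mul_comm]
    gcongr
  · refine lintegral_mono fun x => ?_
    simp only [Pi.mul_apply]
    rw [mul_comm]
    gcongr
    exact hgu x

lemma exists_le_two_mul_shift {w : ℕ → ℝ} {c : ℝ} (hc : 0 < c) (hw : ∀ j : ℕ, c / (j + 2) ≤ w j)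
    (J : ℕ) : ∃ a, w a ≤ 2 * w (a + J) := by
  by_contra! hcon
  have hk : ∀ k : ℕ, 2 ^ k * w (k * J) ≤ w 0 := by
    intro k
    induction k with
    | zero => simp
    | succ k ih =>
      have := hcon (k * J)
      rw [Nat.succ_mul, pow_succ]
      nlinarith [pow_pos (two_pos : (0:ℝ) < 2) k]
  have hb : ∀ k : ℕ, c ≤ w 0 * (J * ((k : ℝ) ^ 1 / 2 ^ k) + 2 * ((k : ℝ) ^ 0 / 2 ^ k)) := by
    intro k
    have h1 := hw (k * J)
    have h2 : (2:ℝ) ^ k * (c / (((k * J : ℕ) : ℝ) + 2)) ≤ w 0 :=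
      (mul_le_mul_of_nonneg_left h1 (by positivity)).trans (hk k)
    have hpos : (0:ℝ) < ((k * J : ℕ) : ℝ) + 2 := by positivity
    rw [← mul_div_assoc, div_le_iff₀ hpos] at h2
    have : w 0 * (J * ((k : ℝ) ^ 1 / 2 ^ k) + 2 * ((k : ℝ) ^ 0 / 2 ^ k)) =
        w 0 * (((k * J : ℕ) : ℝ) + 2) / 2 ^ k := by push_cast; field_simp
    rw [this, le_div_iff₀ (by positivity)]
    linarith
  have ht1 := tendsto_pow_const_div_const_pow_of_one_lt 1 (one_lt_two : (1:ℝ) < 2)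
  have ht0 := tendsto_pow_const_div_const_pow_of_one_lt 0 (one_lt_two : (1:ℝ) < 2)
  have := ge_of_tendsto' (((ht1.const_mul (J : ℝ)).add (ht0.const_mul 2)).const_mul (w 0)) hb
  simp at this
  linarith

/-- The weight `1 / ((1 - r) (log (e / (1 - r)))²)`. -/
def logWeight (r : ℝ) : ℝ := (1 - r)⁻¹ * ((1 - Real.log (1 - r)) ^ 2)⁻¹

/-- The tail integral `1 / log (e / (1 - r))` of `logWeight`, extended continuously to `r = 1`. -/
def logTail (r : ℝ) : ℝ := if r < 1 then (1 - Real.log (1 - r))⁻¹ else 0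

lemma one_le_one_sub_log {r : ℝ} (hr : 0 ≤ r) (hr1 : r < 1) : 1 ≤ 1 - Real.log (1 - r) := by
  have := Real.log_nonpos (by linarith : 0 ≤ 1 - r) (by linarith)
  linarith

lemma logWeight_pos {r : ℝ} (hr : 0 ≤ r) (hr1 : r < 1) : 0 < logWeight r := by
  have h := one_le_one_sub_log hr hr1
  have h1 : 0 < 1 - r := by linarith
  unfold logWeight
  positivity

lemma measurable_logWeight : Measurable logWeight := by
  unfold logWeight; fun_prop

lemma tendsto_one_sub_log : Tendsto (fun r : ℝ => 1 - Real.log (1 - r))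
    (nhdsWithin 1 (Set.Iio 1)) atTop := by
  have h1 : Tendsto (fun r : ℝ => 1 - r) (nhdsWithin 1 (Set.Iio 1)) (nhdsWithin 0 (Set.Ioi 0)) := by
    refine tendsto_nhdsWithin_iff.mpr ⟨?_, ?_⟩
    · have : Tendsto (fun r : ℝ => 1 - r) (nhds 1) (nhds (1 - 1)) := by
        apply Continuous.tendsto; fun_prop
      rw [sub_self] at this
      exact this.mono_left nhdsWithin_le_nhds
    · filter_upwards [self_mem_nhdsWithin] with r hr
      simpa using hr
  have h2 := Real.tendsto_log_nhdsGT_zero.comp h1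
  simpa [sub_eq_add_neg] using tendsto_atTop_add_const_left _ 1 (tendsto_neg_atBot_atTop.comp h2)

lemma hasDerivAt_neg_logTail {r : ℝ} (hr : 0 ≤ r) (hr1 : r < 1) :
    HasDerivAt (fun x => -logTail x) (logWeight r) r := by
  have h := one_le_one_sub_log hr hr1
  have h1 : 1 - r ≠ 0 := by linarith
  have hd : HasDerivAt (fun x : ℝ => -(1 - Real.log (1 - x))⁻¹) (logWeight r) r := by
    have hl : HasDerivAt (fun x : ℝ => 1 - Real.log (1 - x)) (1 - r)⁻¹ r := by
      simpa [neg_div] using (((hasDerivAt_id' r).const_sub 1).log h1).const_sub 1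
    refine (hl.fun_inv (by linarith)).fun_neg.congr_deriv ?_
    rw [logWeight, neg_div, neg_neg, div_eq_mul_inv]
  refine hd.congr_of_eventuallyEq ?_
  filter_upwards [Iio_mem_nhds hr1] with x hx
  simp [logTail, Set.mem_Iio.mp hx]

lemma continuousOn_neg_logTail {r : ℝ} (hr : 0 ≤ r) :
    ContinuousOn (fun x => -logTail x) (Set.Icc r 1) := by
  intro x hx
  rcases hx.2.lt_or_eq with h | rfl
  · exact (hasDerivAt_neg_logTail (hr.trans hx.1) h).continuousAt.continuousWithinAt
  · have hlt : Tendsto logTail (nhdsWithin 1 (Set.Iio 1)) (nhds 0) := by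
      refine (tendsto_inv_atTop_zero.comp tendsto_one_sub_log).congr' ?_
      filter_upwards [self_mem_nhdsWithin] with y hy
      simp [logTail, Set.mem_Iio.mp hy]
    have h1 : logTail 1 = 0 := by simp [logTail]
    have : ContinuousWithinAt logTail (Set.Iio 1) 1 := by
      unfold ContinuousWithinAt; rw [h1]; exact hlt
    have h2 := this.insert.neg
    rw [Set.Iio_insert] at h2
    exact h2.mono fun y hy => hy.2

lemma integrableOn_logWeight {r : ℝ} (hr : 0 ≤ r) : IntegrableOn logWeight (Set.Ioc r 1) :=
  intervalIntegral.integrableOn_deriv_of_nonneg (continuousOn_neg_logTail hr)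
    (fun _ hx => hasDerivAt_neg_logTail (hr.trans hx.1.le) hx.2)
    (fun _ hx => (logWeight_pos (hr.trans hx.1.le) hx.2).le)

lemma wInt_logWeight {r : ℝ} (hr : 0 ≤ r) (hr1 : r < 1) :
    wInt logWeight r = (1 - Real.log (1 - r))⁻¹ := by
  unfold wInt
  rw [intervalIntegral.integral_eq_sub_of_hasDerivAt_of_le hr1.le (continuousOn_neg_logTail hr)
    (fun x hx => hasDerivAt_neg_logTail (hr.trans hx.1.le) hx.2)
    ((intervalIntegrable_iff_integrableOn_Ioc_of_le hr1.le).mpr (integrableOn_logWeight hr))]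
  simp [logTail, hr1]

lemma isRadialContinuousWeight_logWeight : IsRadialContinuousWeight logWeight := by
  refine ⟨⟨fun r hr => logWeight_pos hr.1 hr.2, ?_⟩, fun r hr => ?_⟩
  · rw [integrableOn_Ico_iff_integrableOn_Ioo]
    exact (integrableOn_logWeight le_rfl).mono_set Set.Ioo_subset_Ioc_self
  · have h := one_le_one_sub_log hr.1 hr.2
    have h1 : 1 - r ≠ 0 := by linarith [hr.2]
    have h2 : (1 - Real.log (1 - r)) ^ 2 ≠ 0 := by positivity
    apply ContinuousAt.continuousWithinAt
    unfold logWeight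
    fun_prop (disch := assumption)

lemma isRapidlyIncreasing_logWeight : IsRapidlyIncreasing logWeight := by
  refine ⟨isRadialContinuousWeight_logWeight, tendsto_one_sub_log.congr' ?_⟩
  filter_upwards [Ioo_mem_nhdsLT (zero_lt_one' ℝ)] with r hr
  have h := one_le_one_sub_log hr.1.le hr.2
  have h1 : 1 - r ≠ 0 := by linarith [hr.2]
  rw [wInt_logWeight hr.1.le hr.2]
  unfold logWeight
  field_simp

lemma lintegral_comp_norm_complex {g : ℝ → ENNReal} (hg : Measurable g) :
    ∫⁻ z : ℂ, g ‖z‖ = ∫⁻ r in Set.Ioi 0, ENNReal.ofReal (2 * Real.pi * r) * g r := by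
  rw [← Complex.lintegral_comp_polarCoord_symm]
  simp only [polarCoord_target, Complex.norm_polarCoord_symm, smul_eq_mul]
  rw [Measure.volume_eq_prod, ← Measure.prod_restrict,
    lintegral_prod _ (by fun_prop)]
  refine setLIntegral_congr_fun measurableSet_Ioi fun r hr => ?_
  have hr0 : 0 < r := hr
  simp only [lintegral_const, Measure.restrict_apply MeasurableSet.univ, Set.univ_inter,
    Real.volume_Ioo, abs_of_pos hr0]
  rw [mul_right_comm, ← ENNReal.ofReal_mul hr0.le]
  congr 2
  ring

lemma measurableSet_unitDisc : MeasurableSet unitDisc :=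
  measurableSet_lt measurable_norm measurable_const

/-- The measure `ω dA` on the unit disc with `ω` the logarithmic weight. -/
def logMeasure : Measure ℂ :=
  (volume.restrict unitDisc).withDensity fun z => ENNReal.ofReal (logWeight ‖z‖)

lemma logMeasure_norm_preimage {s : Set ℝ} (hs : MeasurableSet s) :
    logMeasure {z | ‖z‖ ∈ s} = ∫⁻ r in s ∩ Set.Ioo 0 1,
      ENNReal.ofReal (2 * Real.pi * r) * ENNReal.ofReal (logWeight r) := by
  have hs' : MeasurableSet {z : ℂ | ‖z‖ ∈ s} := measurable_norm hs
  have hm : MeasurableSet (s ∩ Set.Iio 1) := hs.inter measurableSet_Iio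
  have hW : Measurable fun r => ENNReal.ofReal (logWeight r) :=
    measurable_logWeight.ennreal_ofReal
  unfold logMeasure
  rw [withDensity_apply _ hs', Measure.restrict_restrict hs', ← lintegral_indicator
    (hs'.inter measurableSet_unitDisc)]
  have e : ∀ z : ℂ, ({z : ℂ | ‖z‖ ∈ s} ∩ unitDisc).indicator
      (fun z => ENNReal.ofReal (logWeight ‖z‖)) z =
      (s ∩ Set.Iio 1).indicator (fun r => ENNReal.ofReal (logWeight r)) ‖z‖ := by
    intro z
    by_cases hz : z ∈ {z : ℂ | ‖z‖ ∈ s} ∩ unitDisc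
    · rw [Set.indicator_of_mem hz, Set.indicator_of_mem (show ‖z‖ ∈ s ∩ Set.Iio 1 from hz)]
    · rw [Set.indicator_of_notMem hz, Set.indicator_of_notMem (show ‖z‖ ∉ s ∩ Set.Iio 1 from hz)]
  simp only [e]
  rw [lintegral_comp_norm_complex (hW.indicator hm)]
  simp only [← Set.indicator_mul_right (s ∩ Set.Iio 1) (fun r => ENNReal.ofReal (2 * Real.pi * r))]
  rw [setLIntegral_indicator hm, Set.inter_assoc, Set.inter_comm (Set.Iio 1), Set.Ioi_inter_Iio]

lemma ae_norm_le_one_of_absolutelyContinuous {ν : Measure ℂ}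
    (h : ν.AbsolutelyContinuous (volume.restrict unitDisc)) : ∀ᵐ z ∂ν, ‖z‖ ≤ 1 :=
  h.ae_le (((ae_restrict_mem measurableSet_unitDisc)).mono fun _ hz => le_of_lt hz)

lemma logMeasure_univ_lt_top : logMeasure Set.univ < ⊤ := by
  have h := logMeasure_norm_preimage MeasurableSet.univ
  simp only [Set.mem_univ, Set.ofPred_true, Set.univ_inter] at h
  rw [h]
  calc _ ≤ ∫⁻ r in Set.Ioo 0 1, ENNReal.ofReal (2 * Real.pi) * ENNReal.ofReal (logWeight r) := by
        refine setLIntegral_mono' measurableSet_Ioo fun r hr => ?_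
        refine mul_le_mul_left (ENNReal.ofReal_le_ofReal ?_) _
        nlinarith [Real.pi_pos, hr.2]
    _ = ENNReal.ofReal (2 * Real.pi) * ∫⁻ r in Set.Ioo 0 1, ENNReal.ofReal (logWeight r) :=
        lintegral_const_mul' _ _ ENNReal.ofReal_ne_top
    _ < ⊤ := by
        refine ENNReal.mul_lt_top ENNReal.ofReal_lt_top ?_
        exact ((integrableOn_logWeight le_rfl).mono_set
          Set.Ioo_subset_Ioc_self).lintegral_lt_top

lemma le_logMeasure_annulus {ρ : ℝ} (hρ : 1 / 2 ≤ ρ) (hρ1 : ρ < 1) :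
    ENNReal.ofReal (1 - Real.log (1 - ρ))⁻¹ ≤ logMeasure {z | ‖z‖ ∈ Set.Ioi ρ} := by
  have hρ0 : 0 ≤ ρ := by linarith
  rw [logMeasure_norm_preimage measurableSet_Ioi, ← Set.Ioi_inter_Iio, ← Set.inter_assoc,
    Set.inter_eq_left.mpr (Set.Ioi_subset_Ioi hρ0), Set.Ioi_inter_Iio,
    ← wInt_logWeight hρ0 hρ1, wInt, intervalIntegral.integral_of_le hρ1.le,
    ofReal_integral_eq_lintegral_ofReal, ← restrict_Ioo_eq_restrict_Ioc]
  · refine setLIntegral_mono' measurableSet_Ioo fun r hr => ?_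
    refine le_mul_of_one_le_left' ?_
    rw [ENNReal.one_le_ofReal]
    nlinarith [Real.pi_gt_three, hr.1]
  · exact integrableOn_logWeight hρ0
  · rw [← restrict_Ioo_eq_restrict_Ioc]
    exact (ae_restrict_mem measurableSet_Ioo).mono fun r hr =>
      (logWeight_pos (hρ0.trans hr.1.le) hr.2).le

lemma ae_logMeasure_norm_le_one : ∀ᵐ z ∂logMeasure, ‖z‖ ≤ 1 :=
  ae_norm_le_one_of_absolutelyContinuous (withDensity_absolutelyContinuous _ _)

lemma antitone_logMeasure_moment {p : ℝ} (hp : 0 < p) :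
    Antitone fun j : ℕ => ∫⁻ z, ENNReal.ofReal ((‖z‖ ^ 2 ^ j) ^ p) ∂logMeasure := by
  intro i j hij
  refine lintegral_mono_ae (ae_logMeasure_norm_le_one.mono fun z hz => ?_)
  refine ENNReal.ofReal_le_ofReal (Real.rpow_le_rpow (by positivity) ?_ hp.le)
  exact pow_le_pow_of_le_one (norm_nonneg _) hz (Nat.pow_le_pow_right two_pos hij)

lemma logMeasure_moment_ne_top {p : ℝ} (hp : 0 < p) (j : ℕ) :
    ∫⁻ z, ENNReal.ofReal ((‖z‖ ^ 2 ^ j) ^ p) ∂logMeasure ≠ ⊤ := by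
  refine ne_top_of_le_ne_top logMeasure_univ_lt_top.ne ?_
  rw [← lintegral_one]
  refine lintegral_mono_ae (ae_logMeasure_norm_le_one.mono fun z hz => ?_)
  rw [ENNReal.ofReal_le_one]
  exact Real.rpow_le_one (by positivity) (pow_le_one₀ (norm_nonneg _) hz) hp.le

lemma le_logMeasure_moment {p : ℝ} (hp : 0 < p) (j : ℕ) :
    ENNReal.ofReal ((1 / 2) ^ p / (j + 2)) ≤
      ∫⁻ z, ENNReal.ofReal ((‖z‖ ^ 2 ^ j) ^ p) ∂logMeasure := by
  set ρ : ℝ := 1 - ((2:ℝ) ^ (j + 1))⁻¹ with hρ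
  have hpow : (2:ℝ) ≤ 2 ^ (j + 1) := le_self_pow₀ one_le_two (by omega)
  have hinv : ((2:ℝ) ^ (j + 1))⁻¹ ≤ 1 / 2 := by
    rw [one_div]; exact inv_anti₀ two_pos hpow
  have hinv0 : 0 < ((2:ℝ) ^ (j + 1))⁻¹ := by positivity
  have hpt : 1 / 2 ≤ ρ ^ 2 ^ j := by
    have := one_add_mul_le_pow (a := -((2:ℝ) ^ (j + 1))⁻¹) (by linarith) (2 ^ j)
    refine le_trans (le_of_eq ?_) this
    push_cast
    rw [pow_succ]
    field_simp
    norm_num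
  have hlog : 1 - Real.log (1 - ρ) ≤ j + 2 := by
    have : 1 - ρ = ((2:ℝ) ^ (j + 1))⁻¹ := by rw [hρ]; ring
    rw [this, Real.log_inv, Real.log_pow]
    have := Real.log_two_lt_d9
    push_cast
    nlinarith [(Nat.cast_nonneg j : (0:ℝ) ≤ j)]
  have h1 : 1 ≤ 1 - Real.log (1 - ρ) := one_le_one_sub_log (by linarith) (by linarith)
  calc ENNReal.ofReal ((1 / 2) ^ p / (j + 2))
      ≤ ENNReal.ofReal ((1 / 2) ^ p) * ENNReal.ofReal (1 - Real.log (1 - ρ))⁻¹ := by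
        rw [← ENNReal.ofReal_mul (by positivity), div_eq_mul_inv]
        gcongr
    _ ≤ ENNReal.ofReal ((1 / 2) ^ p) * logMeasure {z | ‖z‖ ∈ Set.Ioi ρ} := by
        gcongr
        exact le_logMeasure_annulus (by linarith) (by linarith)
    _ = ∫⁻ _ in {z | ‖z‖ ∈ Set.Ioi ρ}, ENNReal.ofReal ((1 / 2) ^ p) ∂logMeasure := by
        rw [setLIntegral_const]
    _ ≤ ∫⁻ z in {z | ‖z‖ ∈ Set.Ioi ρ}, ENNReal.ofReal ((‖z‖ ^ 2 ^ j) ^ p) ∂logMeasure := by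
        refine setLIntegral_mono' (measurable_norm measurableSet_Ioi) fun z hz => ?_
        refine ENNReal.ofReal_le_ofReal (Real.rpow_le_rpow (by positivity) ?_ hp.le)
        exact hpt.trans (pow_le_pow_left₀ (by linarith) (le_of_lt hz) _)
    _ ≤ _ := setLIntegral_le_lintegral _ _

theorem not_derivComparable_logMeasure {p C₁ C₂ : ℝ} (hp : 0 < p) (hp2 : p ≠ 2) (hC₁ : 0 < C₁)
    (hC₂ : 0 < C₂) {ν : Measure ℂ} (hν : ν.AbsolutelyContinuous (volume.restrict unitDisc)) :
    ¬ DerivComparable p logMeasure ν C₁ C₂ := by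
  intro h
  set w : ℕ → ℝ := fun j => (∫⁻ z, ENNReal.ofReal ((‖z‖ ^ 2 ^ j) ^ p) ∂logMeasure).toReal with hwdef
  have hc : 0 < (1 / 2 : ℝ) ^ p := by positivity
  have hlow : ∀ j : ℕ, (1 / 2 : ℝ) ^ p / (j + 2) ≤ w j := fun j =>
    (ENNReal.ofReal_le_iff_le_toReal (logMeasure_moment_ne_top hp j)).mp (le_logMeasure_moment hp j)
  exact h.false_of_slow_moments hp hp2 hC₁ hC₂ ae_logMeasure_norm_le_one
    (ae_norm_le_one_of_absolutelyContinuous hν)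
    (fun j => (ENNReal.ofReal_toReal (logMeasure_moment_ne_top hp j)).symm)
    (fun j => lt_of_lt_of_le (by positivity) (hlow j))
    (fun i j hij => ENNReal.toReal_mono (logMeasure_moment_ne_top hp i)
      (antitone_logMeasure_moment hp hij))
    (fun J _ => exists_le_two_mul_shift hc hlow J)

theorem stmt11 (p : ℝ) (hp : 0 < p) (hp2 : p ≠ 2) :
    ∃ ω : ℝ → ℝ, IsRadialContinuousWeight ω ∧ IsRapidlyIncreasing ω ∧
      ∀ φ : ℝ → ℝ, (∀ r ∈ Set.Ico (0:ℝ) 1, 0 < φ r) →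
        ¬ ∃ C₁ C₂ : ℝ, 0 < C₁ ∧ 0 < C₂ ∧
          ∀ f : ℂ → ℂ, DifferentiableOn ℂ f unitDisc →
            (ENNReal.ofReal C₁ *
                ((∫⁻ z in unitDisc,
                    ENNReal.ofReal (‖deriv f z‖ ^ p * φ ‖z‖ ^ p * ω ‖z‖)) +
                  ENNReal.ofReal (‖f 0‖ ^ p)) ≤
              (∫⁻ z in unitDisc, ENNReal.ofReal (‖f z‖ ^ p * ω ‖z‖))) ∧
            (∫⁻ z in unitDisc, ENNReal.ofReal (‖f z‖ ^ p * ω ‖z‖)) ≤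
              ENNReal.ofReal C₂ *
                ((∫⁻ z in unitDisc,
                    ENNReal.ofReal (‖deriv f z‖ ^ p * φ ‖z‖ ^ p * ω ‖z‖)) +
                  ENNReal.ofReal (‖f 0‖ ^ p)) := by
  refine ⟨logWeight, isRadialContinuousWeight_logWeight, isRapidlyIncreasing_logWeight,
    fun φ _ => ?_⟩
  rintro ⟨C₁, C₂, hC₁, hC₂, H⟩
  refine not_derivComparable_logMeasure hp hp2 hC₁ hC₂ (ν := (volume.restrict unitDisc).withDensity
    fun z => ENNReal.ofReal (φ ‖z‖ ^ p * logWeight ‖z‖)) (withDensity_absolutelyContinuous _ _)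
    fun f hf hf0 => ?_
  have h := H f hf.differentiableOn
  have hfm : Measurable f := hf.continuous.measurable
  have e : ∀ (g : ℂ → ℂ) (u : ℂ → ℝ), Measurable g →
      ∫⁻ z in unitDisc, ENNReal.ofReal (‖g z‖ ^ p * u z) =
        ∫⁻ z, ENNReal.ofReal (‖g z‖ ^ p)
          ∂(volume.restrict unitDisc).withDensity fun z => ENNReal.ofReal (u z) := by
    intro g u hg
    rw [← lintegral_mul_eq_lintegral_withDensity (by fun_prop) (fun _ => ENNReal.ofReal_lt_top)]
    exact lintegral_congr fun z => ENNReal.ofReal_mul (by positivity)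
  simp only [mul_assoc, hf0, norm_zero, Real.zero_rpow hp.ne', ENNReal.ofReal_zero, add_zero] at h
  rw [e _ (fun z => φ ‖z‖ ^ p * logWeight ‖z‖) (measurable_deriv f),
    e f (fun z => logWeight ‖z‖) hfm] at h
  exact h
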